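/- Let N ≥ 0 and let α, β ∈ ℝ with β ≠ 0. There is no smooth function u : (N, ∞) × ℝ² → ℝ such that: (i) u(ϱ, x+1, y) = u(ϱ, x, y) and u(ϱ, x+α, y+β) = u(ϱ, x, y) for all (ϱ, x, y) ∈ (N, ∞) × ℝ²; (ii) u satisfies the SU(∞) Toda equation ∂²(e^u)/∂ϱ² + ∂²u/∂x² + ∂²u/∂y² = 0 at every point of (N, ∞) × ℝ²; and (iii) −12ϱ + 6ϱ² ∂u/∂ϱ(ϱ, x, y) > 0 at every point of (N, ∞) × ℝ². -/

import Mathlib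

open Set Real

/-- Second-derivative necessary condition at a local minimum. -/
theorem deriv_deriv_nonneg_of_isLocalMin {f : ℝ → ℝ} {x : ℝ} (h : IsLocalMin f x)
    (hc : ContinuousAt f x) : 0 ≤ deriv (deriv f) x := by
  by_contra! hneg
  have hmax : IsLocalMax f x := isLocalMax_of_deriv_deriv_neg hneg h.deriv_eq_zero hc
  have heq : f =ᶠ[nhds x] fun _ => f x := by
    filter_upwards [h, hmax] with y h₁ h₂ using le_antisymm h₂ h₁
  have hzero := heq.deriv.deriv_eq
  simp at hzero
  exact hneg.ne hzero

/-- Every point of the plane is equivalent to a point of a fixed rectangle modulo the lattice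
spanned by `(1, 0)` and `(α, β)`. -/
theorem exists_mem_rectangle_of_doublyPeriodic {α β : ℝ} (hβ : β ≠ 0) {f : ℝ → ℝ → ℝ}
    (h₁ : ∀ x y, f (x + 1) y = f x y) (h₂ : ∀ x y, f (x + α) (y + β) = f x y) (x y : ℝ) :
    ∃ x' ∈ Icc (0 : ℝ) 1, ∃ y' ∈ Icc (-|β|) |β|, f x' y' = f x y := by
  have hx : ∀ y, Function.Periodic (fun x => f x y) 1 := fun y x => h₁ x y
  have hp : Function.Periodic (fun p : ℝ × ℝ => f p.1 p.2) (α, β) := fun p => h₂ p.1 p.2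
  set n := ⌊y / β⌋
  have hy : y - n * β = Int.fract (y / β) * β := by
    have := Int.self_sub_floor (y / β)
    rw [← this, sub_mul, div_mul_cancel₀ y hβ]
  have hp' := hp.sub_zsmul_eq (x := (x, y)) n
  simp only [Prod.fst_sub, Prod.snd_sub, Prod.smul_mk, zsmul_eq_mul] at hp'
  set x₀ := x - n * α
  have hx' := (hx (y - n * β)).sub_zsmul_eq (x := x₀) ⌊x₀⌋
  simp only [zsmul_eq_mul, mul_one, Int.self_sub_floor] at hx'
  refine ⟨Int.fract x₀, ⟨Int.fract_nonneg _, (Int.fract_lt_one _).le⟩, y - n * β, ?_,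
    hx'.trans hp'⟩
  rw [mem_Icc, ← abs_le, hy, abs_mul, abs_of_nonneg (Int.fract_nonneg _)]
  exact mul_le_of_le_one_left (abs_nonneg _) (Int.fract_lt_one _).le

/-- A function with `f' > 2 / r` grows so fast that `exp f` dominates a quadratic. -/
theorem exp_mul_sq_le_of_deriv {N : ℝ} (hN : 0 ≤ N) {f : ℝ → ℝ}
    (hd : DifferentiableOn ℝ f (Ioi N)) (hV : ∀ r ∈ Ioi N, 0 < -12 * r + 6 * r ^ 2 * deriv f r)
    {a r : ℝ} (ha : N < a) (har : a ≤ r) : exp (f a) * r ^ 2 ≤ exp (f r) * a ^ 2 := by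
  have hder : ∀ s ∈ Ioi N, HasDerivAt (fun s => f s - 2 * log s) (deriv f s - 2 * s⁻¹) s := by
    intro s hs
    have hs0 : s ≠ 0 := (hN.trans_lt hs).ne'
    exact ((hd s hs).differentiableAt (Ioi_mem_nhds hs)).hasDerivAt.sub
      ((hasDerivAt_log hs0).const_mul 2)
  have hmono : MonotoneOn (fun s => f s - 2 * log s) (Ioi N) := by
    refine monotoneOn_of_deriv_nonneg (convex_Ioi N)
      (fun s hs => (hder s hs).continuousAt.continuousWithinAt)
      (fun s hs => (hder s (interior_subset hs)).differentiableAt.differentiableWithinAt) ?_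
    intro s hs
    have hs' : N < s := interior_subset hs
    have hs0 : 0 < s := hN.trans_lt hs'
    rw [(hder s hs').deriv]
    have h : 0 < 6 * s ^ 2 * (deriv f s - 2 * s⁻¹) := by
      have := hV s hs'
      have e : 6 * s ^ 2 * (deriv f s - 2 * s⁻¹) = -12 * s + 6 * s ^ 2 * deriv f s := by
        field_simp
        ring
      rwa [e]
    exact (pos_of_mul_pos_right h (by positivity)).le
  have ha0 : 0 < a := hN.trans_lt ha
  have hr0 : 0 < r := ha0.trans_le har
  have h := hmono ha (ha.trans_le har) har
  have hsq : ∀ s : ℝ, 0 < s → s ^ 2 = exp (2 * log s) := fun s hs => by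
    rw [two_mul, exp_add, exp_log hs, sq]
  rw [hsq r hr0, hsq a ha0, ← exp_add, ← exp_add, exp_le_exp]
  simp only at h
  linarith

/-- **No doubly-periodic Toda solutions with positive `V` on `(N, ∞) × ℝ²`.**
There is no smooth function `u` on `(N, ∞) × ℝ²` that is doubly periodic in `(x, y)`
with periods `(1, 0)` and `(α, β)` (`β ≠ 0`), satisfies the `SU(∞)` Toda equation
`∂²(e^u)/∂ϱ² + ∂²u/∂x² + ∂²u/∂y² = 0`, and has `V = -12ϱ + 6ϱ² ∂u/∂ϱ > 0` everywhere. -/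
theorem no_periodic_toda_solution_with_positive_V
    (N : ℝ) (hN : 0 ≤ N) (α β : ℝ) (hβ : β ≠ 0) :
    ¬ ∃ u : ℝ → ℝ → ℝ → ℝ,
      ContDiffOn ℝ (⊤ : ℕ∞) (fun p : ℝ × ℝ × ℝ => u p.1 p.2.1 p.2.2)
        (Ioi N ×ˢ (univ : Set (ℝ × ℝ))) ∧
      (∀ ϱ ∈ Ioi N, ∀ x y : ℝ,
        u ϱ (x + 1) y = u ϱ x y ∧ u ϱ (x + α) (y + β) = u ϱ x y) ∧
      (∀ ϱ ∈ Ioi N, ∀ x y : ℝ,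
        deriv (fun r => deriv (fun r' => Real.exp (u r' x y)) r) ϱ
          + deriv (fun s => deriv (fun s' => u ϱ s' y) s) x
          + deriv (fun t => deriv (fun t' => u ϱ x t') t) y = 0) ∧
      (∀ ϱ ∈ Ioi N, ∀ x y : ℝ,
        0 < -12 * ϱ + 6 * ϱ ^ 2 * deriv (fun r => u r x y) ϱ) := by
  rintro ⟨u, hu, hper, htoda, hV⟩
  have hopen : IsOpen (Ioi N ×ˢ (univ : Set (ℝ × ℝ))) := isOpen_Ioi.prod isOpen_univ
  have hat : ∀ r ∈ Ioi N, ∀ x y : ℝ,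
      ContDiffAt ℝ (⊤ : ℕ∞) (fun p : ℝ × ℝ × ℝ => u p.1 p.2.1 p.2.2) (r, x, y) :=
    fun r hr x y => hu.contDiffAt (hopen.mem_nhds ⟨hr, mem_univ _⟩)
  have hslice : ∀ x y : ℝ, ∀ r ∈ Ioi N, ContDiffAt ℝ (⊤ : ℕ∞) (fun r => u r x y) r :=
    fun x y r hr => (hat r hr x y).comp (f := fun r : ℝ => (r, x, y)) r (by fun_prop)
  have hgrow : ∀ a r x y : ℝ, N < a → a ≤ r →
      exp (u a x y) * r ^ 2 ≤ exp (u r x y) * a ^ 2 := fun a r x y ha har =>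
    exp_mul_sq_le_of_deriv (f := fun r => u r x y) hN
      (fun s hs => ((hslice x y s hs).differentiableAt (by simp)).differentiableWithinAt)
      (fun s hs => hV s hs x y) ha har
  have hrect : ∀ r ∈ Ioi N, ∀ x y : ℝ,
      ∃ x' ∈ Icc (0 : ℝ) 1, ∃ y' ∈ Icc (-|β|) |β|, u r x' y' = u r x y := fun r hr x y =>
    exists_mem_rectangle_of_doublyPeriodic hβ (fun x y => (hper r hr x y).1)
      (fun x y => (hper r hr x y).2) x y
  have hmin : ∀ a b k l : ℝ, N < a → a ≤ b → ∃ r₀ ∈ Icc a b, ∃ x₀ y₀ : ℝ,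
      ∀ r ∈ Icc a b, ∀ x y : ℝ, exp (u r₀ x₀ y₀) - (k * r₀ ^ 2 + l * r₀)
        ≤ exp (u r x y) - (k * r ^ 2 + l * r) := by
    intro a b k l ha hab
    obtain ⟨p, hp, hpmin⟩ := (isCompact_Icc.prod (isCompact_Icc.prod isCompact_Icc) :
        IsCompact (Icc a b ×ˢ (Icc (0 : ℝ) 1 ×ˢ Icc (-|β|) |β|))).exists_isMinOn
      (f := fun p : ℝ × ℝ × ℝ => exp (u p.1 p.2.1 p.2.2) - (k * p.1 ^ 2 + l * p.1))
      ⟨(a, 0, 0), by simp [hab]⟩ (fun p hp => by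
        have := (hat p.1 (ha.trans_le hp.1.1) p.2.1 p.2.2).continuousAt
        exact (this.rexp.sub (by fun_prop)).continuousWithinAt)
    refine ⟨p.1, hp.1, p.2.1, p.2.2, fun r hr x y => ?_⟩
    obtain ⟨x', hx', y', hy', h⟩ := hrect r (ha.trans_le hr.1) x y
    rw [← h]
    exact hpmin (a := (r, x', y')) ⟨hr, hx', hy'⟩
  set a := N + 1
  have ha : N < a := lt_add_one N
  have ha0 : 0 < a := hN.trans_lt ha
  obtain ⟨r₁, hr₁, x₁, y₁, h₁⟩ := hmin a a 0 0 ha le_rfl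
  obtain rfl : r₁ = a := le_antisymm hr₁.2 hr₁.1
  set k := exp (u a x₁ y₁) / (2 * a ^ 2) with hk
  have hk0 : 0 < k := by positivity
  have hlow : ∀ r x y : ℝ, a ≤ r → 2 * k * r ^ 2 ≤ exp (u r x y) := by
    intro r x y har
    have h₂ : exp (u a x₁ y₁) ≤ exp (u a x y) := by
      simpa using h₁ a ⟨le_rfl, le_rfl⟩ x y
    have h₃ := hgrow a r x y ha har
    have h₄ : exp (u a x₁ y₁) * r ^ 2 ≤ exp (u r x y) * a ^ 2 :=
      (mul_le_mul_of_nonneg_right h₂ (sq_nonneg r)).trans h₃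
    calc 2 * k * r ^ 2 = exp (u a x₁ y₁) * r ^ 2 / a ^ 2 := by rw [hk]; field_simp
      _ ≤ exp (u r x y) := by rwa [div_le_iff₀ (by positivity)]
  set l := exp (u (a + 1) 0 0)
  have hl0 : 0 < l := exp_pos _
  set b := a + 1 + l / k
  have hbl : a + 1 < b := lt_add_of_pos_right _ (by positivity)
  obtain ⟨r, hr, x, y, h⟩ := hmin a b k l ha (by linarith)
  have hval : exp (u r x y) - (k * r ^ 2 + l * r) < - (l * a) := by
    have := h (a + 1) ⟨by linarith, hbl.le⟩ 0 0
    have : 0 < k * (a + 1) ^ 2 := by positivity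
    linarith
  have hlr := hlow r x y hr.1
  have hra : a < r := by
    refine lt_of_le_of_ne hr.1 fun e => ?_
    rw [← e] at hval hlr
    have : 0 < k * a ^ 2 := by positivity
    linarith
  have hrb : r < b := by
    refine lt_of_le_of_ne hr.2 fun e => ?_
    have hkb : l < k * r := by
      have : k * b = k * (a + 1) + l := by simp only [b]; field_simp
      rw [e, this]
      have : 0 < k * (a + 1) := by positivity
      linarith
    have hr0 : 0 < r := ha0.trans hra
    have : 0 < l * a := by positivity
    nlinarith [mul_lt_mul_of_pos_right hkb hr0]
  have hrN : N < r := ha.trans hra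
  have hspace : ∀ x' y', u r x y ≤ u r x' y' := fun x' y' => by
    simpa using h r hr x' y'
  have hxx : 0 ≤ deriv (deriv fun s => u r s y) x :=
    deriv_deriv_nonneg_of_isLocalMin (Filter.Eventually.of_forall fun s => hspace s y)
      ((hat r hrN x y).continuousAt.comp (f := fun s : ℝ => (r, s, y)) (by fun_prop))
  have hyy : 0 ≤ deriv (deriv fun t => u r x t) y :=
    deriv_deriv_nonneg_of_isLocalMin (Filter.Eventually.of_forall fun t => hspace x t)
      ((hat r hrN x y).continuousAt.comp (f := fun t : ℝ => (r, x, t)) (by fun_prop))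
  have hsmooth : ∀ s ∈ Ioi N, ContDiffAt ℝ (⊤ : ℕ∞) (fun s => exp (u s x y)) s :=
    fun s hs => (hslice x y s hs).exp
  have hrr : 0 ≤ deriv (deriv fun s => exp (u s x y) - (k * s ^ 2 + l * s)) r :=
    deriv_deriv_nonneg_of_isLocalMin
      (by filter_upwards [Icc_mem_nhds hra hrb] with s hs using h s hs x y)
      ((hsmooth r hrN).continuousAt.sub (by fun_prop))
  have hq : ∀ s, HasDerivAt (fun s => k * s ^ 2 + l * s) (2 * k * s + l) s := fun s => by
    refine (((hasDerivAt_pow 2 s).const_mul k).fun_add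
      ((hasDerivAt_id' s).const_mul l)).congr_deriv ?_
    norm_num
    ring
  have hderiv : deriv (fun s => exp (u s x y) - (k * s ^ 2 + l * s))
      =ᶠ[nhds r] fun s => deriv (fun s => exp (u s x y)) s - (2 * k * s + l) := by
    filter_upwards [Ioi_mem_nhds hrN] with s hs
    exact (((hsmooth s hs).differentiableAt (by simp)).hasDerivAt.sub (hq s)).deriv
  have hdiff : DifferentiableAt ℝ (deriv fun s => exp (u s x y)) r :=
    ((hsmooth r hrN).fderiv_right (m := 1) (by norm_cast)).differentiableAt one_ne_zero
      |>.clm_apply (differentiableAt_const (1 : ℝ))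
  have hlin : HasDerivAt (fun s => 2 * k * s + l) (2 * k) r := by
    simpa using ((hasDerivAt_id r).const_mul (2 * k)).add_const l
  rw [hderiv.deriv_eq, (hdiff.hasDerivAt.fun_sub hlin).deriv] at hrr
  have := htoda r hrN x y
  linarith
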